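/- Under the stated assumptions, the map x ↦ y*(x) is differentiable at every x ∈ E, and its derivative is given by D y*(x) = −(∇²_{yy} g(x, y*(x)))⁻¹ ∘ ∇²_{yx} g(x, y*(x)), where ∇²_{yy} g(x,y) : F → F is the partial Hessian in y (invertible since it is ≥ μ·Id by strong convexity) and ∇²_{yx} g(x,y) : E → F is the mixed second partial derivative. -/

import Mathlib

open Real Set

noncomputable section

variable {E F : Type*}
  [NormedAddCommGroup E] [InnerProductSpace ℝ E] [FiniteDimensional ℝ E]
  [NormedAddCommGroup F] [InnerProductSpace ℝ F] [FiniteDimensional ℝ F]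

/-- The point `(x, y)` of the `ℓ²` product `WithLp 2 (E × F)`. -/
abbrev pmk (x : E) (y : F) : WithLp 2 (E × F) :=
  (WithLp.equiv 2 (E × F)).symm (x, y)

/-- The partial gradient `∇_y g(x, y) ∈ F`. -/
def grady (g : WithLp 2 (E × F) → ℝ) (x : E) (y : F) : F :=
  ((WithLp.equiv 2 (E × F)) (gradient g (pmk x y))).2

/-- The partial Hessian `∇²_{yy} g(x, y) : F → F`. -/
def hessyy (g : WithLp 2 (E × F) → ℝ) (x : E) (y : F) : F →L[ℝ] F :=
  fderiv ℝ (fun y' : F => grady g x y') y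

/-- The mixed second partial derivative `∇²_{yx} g(x, y) : E → F`. -/
def hessyx (g : WithLp 2 (E × F) → ℝ) (x : E) (y : F) : E →L[ℝ] F :=
  fderiv ℝ (fun x' : E => grady g x' y) x

/-- The first-order characterization of convexity: the tangent lies below the graph. -/
theorem ConvexOn.hasFDerivAt_apply_sub_le {V : Type*} [NormedAddCommGroup V] [NormedSpace ℝ V]
    {f : V → ℝ} (hf : ConvexOn ℝ univ f) {f' : V →L[ℝ] ℝ} {x : V} (hx : HasFDerivAt f f' x)
    (y : V) : f' (y - x) ≤ f y - f x := by
  have hc : ConvexOn ℝ univ (f ∘ AffineMap.lineMap (k := ℝ) x y) := by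
    simpa using hf.comp_affineMap (AffineMap.lineMap (k := ℝ) x y)
  have hd : HasDerivAt (f ∘ AffineMap.lineMap (k := ℝ) x y) (f' (y - x)) 0 :=
    HasFDerivAt.comp_hasDerivAt (0 : ℝ) (by simpa using hx) AffineMap.hasDerivAt_lineMap
  simpa [slope_def_field] using
    hc.le_slope_of_hasDerivAt (mem_univ 0) (mem_univ 1) zero_lt_one hd

/-- The gradient of a strongly convex function is strongly monotone. -/
theorem inner_sub_ge_of_convexOn_sub_sq {V : Type*} [NormedAddCommGroup V]
    [InnerProductSpace ℝ V] [CompleteSpace V] {f : V → ℝ} {f' : V → V} {μ : ℝ}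
    (hf : ConvexOn ℝ univ fun y => f y - μ / 2 * ‖y‖ ^ 2)
    (hf' : ∀ y, HasGradientAt f (f' y) y) (y z : V) :
    μ * ‖y - z‖ ^ 2 ≤ inner ℝ (f' y - f' z) (y - z) := by
  have hd (w : V) := ((hf' w).hasFDerivAt.sub
    ((hasStrictFDerivAt_norm_sq w).hasFDerivAt.const_mul (μ / 2)))
  have h₁ := hf.hasFDerivAt_apply_sub_le (hd y) z
  have h₂ := hf.hasFDerivAt_apply_sub_le (hd z) y
  simp only [sub_apply, smul_apply, InnerProductSpace.toDual_apply_apply,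
    innerSL_apply_apply, smul_eq_mul, nsmul_eq_mul, inner_sub_left, inner_sub_right] at h₁ h₂ ⊢
  rw [norm_sub_sq_real]
  simp only [real_inner_self_eq_norm_sq, real_inner_comm y z] at h₁ h₂ ⊢
  push_cast at h₁ h₂
  linarith

/-- The derivative of a strongly monotone map is coercive. -/
theorem inner_apply_ge_of_stronglyMonotone {V : Type*} [NormedAddCommGroup V]
    [InnerProductSpace ℝ V] {A : V → V} {A' : V →L[ℝ] V} {μ : ℝ} {y : V}
    (hA : ∀ z, μ * ‖z - y‖ ^ 2 ≤ inner ℝ (A z - A y) (z - y)) (hA' : HasFDerivAt A A' y)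
    (v : V) : μ * ‖v‖ ^ 2 ≤ inner ℝ (A' v) v := by
  have hline : HasDerivAt (fun t : ℝ => y + t • v) v 0 := by
    simpa using ((hasDerivAt_id (0 : ℝ)).smul_const v).const_add y
  have hd : HasDerivAt (fun t : ℝ => A (y + t • v)) (A' v) 0 :=
    HasFDerivAt.comp_hasDerivAt (0 : ℝ) (by simpa using hA') hline
  have hlim := (hd.tendsto_slope_zero_right).inner (𝕜 := ℝ) (tendsto_const_nhds (x := v))
  refine ge_of_tendsto hlim ?_
  filter_upwards [self_mem_nhdsWithin] with t (ht : 0 < t)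
  have h := hA (y + t • v)
  simp only [add_sub_cancel_left, norm_smul, inner_smul_right, mul_pow, norm_eq_abs, sq_abs] at h
  simp only [zero_add, zero_smul, add_zero, real_inner_smul_left]
  rw [inv_mul_eq_div, le_div_iff₀ ht]
  nlinarith

/-- A coercive operator on a finite-dimensional space is invertible. -/
theorem ContinuousLinearMap.isInvertible_of_coercive {V : Type*} [NormedAddCommGroup V]
    [InnerProductSpace ℝ V] [FiniteDimensional ℝ V] {A : V →L[ℝ] V} {μ : ℝ} (hμ : 0 < μ)
    (hA : ∀ v, μ * ‖v‖ ^ 2 ≤ inner ℝ (A v) v) : A.IsInvertible := by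
  have hinj : Function.Injective A.toLinearMap := by
    refine (injective_iff_map_eq_zero _).2 fun v hv => ?_
    have h := hA v
    rw [show A v = 0 from hv, inner_zero_left] at h
    have : ‖v‖ ^ 2 ≤ 0 := nonpos_of_mul_nonpos_right h hμ
    simpa using le_antisymm this (sq_nonneg _)
  exact ⟨(LinearEquiv.ofInjectiveEndo A.toLinearMap hinj).toContinuousLinearEquiv, by ext; rfl⟩

/-- `grady g x y` is the gradient of the partial function `g(x, ·)`. -/
theorem hasGradientAt_grady {g : WithLp 2 (E × F) → ℝ} (hg : Differentiable ℝ g) (x : E) (y : F) :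
    HasGradientAt (fun y' : F => g (pmk x y')) (grady g x y) y := by
  rw [hasGradientAt_iff_hasFDerivAt]
  have hp : HasFDerivAt (fun y' : F => pmk x y')
      (((WithLp.prodContinuousLinearEquiv 2 ℝ E F).symm : E × F →L[ℝ] WithLp 2 (E × F)).comp
        (ContinuousLinearMap.inr ℝ E F)) y :=
    (WithLp.prodContinuousLinearEquiv 2 ℝ E F).symm.hasFDerivAt.comp y (hasFDerivAt_prodMk_right x y)
  refine ((hg (pmk x y)).hasGradientAt.hasFDerivAt.comp y hp).congr_fderiv ?_
  ext v
  have h := inner_gradient_left (𝕜 := ℝ) (f := g) (x := pmk x y) (y := WithLp.toLp 2 (0, v))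
  rw [WithLp.prod_inner_apply] at h
  simpa [grady] using h.symm

/-- The partial gradient of a `C²` function is `C¹` in both variables jointly. -/
theorem contDiff_grady {g : WithLp 2 (E × F) → ℝ} (hg : ContDiff ℝ 2 g) :
    ContDiff ℝ 1 fun p : E × F => grady g p.1 p.2 := by
  have hgrad : ContDiff ℝ 1 (gradient g) :=
    (InnerProductSpace.toDual ℝ (WithLp 2 (E × F))).symm.toContinuousLinearEquiv.contDiff.comp
      (hg.fderiv_right (m := 1) le_rfl)
  exact contDiff_snd.comp <| (WithLp.prodContinuousLinearEquiv 2 ℝ E F).contDiff.comp <|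
    hgrad.comp (WithLp.prodContinuousLinearEquiv 2 ℝ E F).symm.contDiff

/-- **Differentiability of the lower-level solution map (implicit function formula).**
If `g` is `C²` with `ℓ`-Lipschitz gradient and `μ`-strongly convex in `y` for every `x`
(`0 < μ ≤ ℓ`), then `x ↦ y*(x)` is differentiable everywhere, with derivative
`D y*(x) = −(∇²_{yy} g(x, y*(x)))⁻¹ ∘ ∇²_{yx} g(x, y*(x))`. -/
theorem ystar_differentiable
    (g : WithLp 2 (E × F) → ℝ) (ℓ μ : ℝ) (hμ : 0 < μ) (hμℓ : μ ≤ ℓ)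
    (hg : ContDiff ℝ 2 g)
    (hlip : LipschitzWith ℓ.toNNReal (gradient g))
    (hsc : ∀ x : E, ConvexOn ℝ Set.univ (fun y : F => g (pmk x y) - μ / 2 * ‖y‖ ^ 2))
    (ystar : E → F)
    (hmin : ∀ x : E, ∀ y : F, g (pmk x (ystar x)) ≤ g (pmk x y)) :
    ∀ x : E, HasFDerivAt ystar
      (-((hessyy g x (ystar x)).inverse.comp (hessyx g x (ystar x)))) x := by
  intro x
  have hgd : Differentiable ℝ g := hg.differentiable (by norm_num)
  have hmono (x : E) := inner_sub_ge_of_convexOn_sub_sq (hsc x) (hasGradientAt_grady hgd x)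
  have hzero (x : E) : grady g x (ystar x) = 0 := by
    have hloc : IsLocalMin (fun y : F => g (pmk x y)) (ystar x) := .of_forall (hmin x)
    simpa using hloc.hasFDerivAt_eq_zero (hasGradientAt_grady hgd x (ystar x)).hasFDerivAt
  have hG : HasStrictFDerivAt (fun p : E × F => grady g p.1 p.2) _ (x, ystar x) :=
    (contDiff_grady hg).contDiffAt.hasStrictFDerivAt one_ne_zero
  set G' := fderiv ℝ (fun p : E × F => grady g p.1 p.2) (x, ystar x)
  have hy : HasFDerivAt (fun y : F => grady g x y) (G' ∘L .inr ℝ E F) (ystar x) :=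
    HasFDerivAt.comp (g := fun p : E × F => grady g p.1 p.2) (ystar x) hG.hasFDerivAt
      (hasFDerivAt_prodMk_right x (ystar x))
  have hx : HasFDerivAt (fun x' : E => grady g x' (ystar x)) (G' ∘L .inl ℝ E F) x :=
    HasFDerivAt.comp (g := fun p : E × F => grady g p.1 p.2) (f := fun x' => (x', ystar x)) x
      hG.hasFDerivAt (hasFDerivAt_prodMk_left x (ystar x))
  have hinv : (G' ∘L .inr ℝ E F).IsInvertible :=
    ContinuousLinearMap.isInvertible_of_coercive hμ
      (inner_apply_ge_of_stronglyMonotone (fun z => hmono x z (ystar x)) hy)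
  rw [hessyy, hessyx, hy.fderiv, hx.fderiv, ← ContinuousLinearMap.neg_comp]
  refine (hG.hasStrictFDerivAt_implicitFunctionOfProdDomain hinv).hasFDerivAt.congr_of_eventuallyEq
    ?_
  filter_upwards [hG.eventually_apply_implicitFunctionOfProdDomain hinv] with x' hx'
  have h := hmono x' (ystar x') (hG.implicitFunctionOfProdDomain hinv x')
  rw [hzero, hx', hzero, sub_zero, inner_zero_left] at h
  have : ‖ystar x' - hG.implicitFunctionOfProdDomain hinv x'‖ ^ 2 ≤ 0 :=
    nonpos_of_mul_nonpos_right h hμ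
  exact sub_eq_zero.1 (by simpa using le_antisymm this (sq_nonneg _))
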